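/- arXiv:2605.26145 — 2 statements merged into one kernel-verified Lean document; each statement's English description precedes it below -/
import Mathlib

section
/- Let P be a set of n points in the plane, n ≥ 2, such that the number of unordered pairs of points of P at Euclidean distance exactly 1 exceeds 4n. Then the number of such unit-distance pairs is at most (100·n³·(n−1))^{1/3}, hence is O(n^{4/3}). -/
/-- The Euclidean plane. -/
abbrev Plane := EuclideanSpace ℝ (Fin 2)

/-- The function whose graph over `[c 0 - 1, c 0 + 1]` is the upper unit semicircle around `c`. -/
noncomputable def semicircle (c : Plane) (x : ℝ) : ℝ := c 1 + √(1 - (x - c 0) ^ 2)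

/-- `p` lies on the closed upper unit semicircle around `c`. -/
def OnSemicircle (c p : Plane) : Prop := |p 0 - c 0| ≤ 1 ∧ p 1 = semicircle c (p 0)

lemma Plane.ext {p q : Plane} (h0 : p 0 = q 0) (h1 : p 1 = q 1) : p = q := by
  ext i
  fin_cases i <;> assumption

lemma strictConcaveOn_sqrt_one_sub_sq :
    StrictConcaveOn ℝ (Set.Icc (-1) 1) fun t : ℝ => √(1 - t ^ 2) := by
  refine ⟨convex_Icc _ _, ?_⟩
  intro t ht u hu htu a b ha hb hab
  simp only [smul_eq_mul]
  have h1 : 0 ≤ 1 - t ^ 2 := by nlinarith [ht.1, ht.2]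
  have h2 : 0 ≤ 1 - u ^ 2 := by nlinarith [hu.1, hu.2]
  have e1 := Real.sq_sqrt h1
  have e2 := Real.sq_sqrt h2
  have n1 := Real.sqrt_nonneg (1 - t ^ 2)
  have n2 := Real.sqrt_nonneg (1 - u ^ 2)
  set v := √(1 - t ^ 2)
  set w := √(1 - u ^ 2)
  apply Real.lt_sqrt_of_sq_lt
  have h3 : 0 < (t - u) ^ 2 := by
    have := sub_ne_zero.2 htu
    positivity
  have h4 : 0 < a * b * ((t - u) ^ 2 + (v - w) ^ 2) := by positivity
  have hb' : b = 1 - a := by linarith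
  subst hb'
  nlinarith

lemma semicircle_sub_lt {c d : Plane} (hcd : c 0 < d 0) {x y : ℝ} (hxy : x < y)
    (hx : |x - d 0| ≤ 1) (hy : |y - c 0| ≤ 1) :
    semicircle c y - semicircle d y < semicircle c x - semicircle d x := by
  rw [abs_le] at hx hy
  have hL : 0 < (y - x) + (d 0 - c 0) := by linarith
  set L := (y - x) + (d 0 - c 0) with hLdef
  have hs : (d 0 - c 0) / L + (y - x) / L = 1 := by
    rw [← add_div, div_eq_one_iff_eq hL.ne']; ring
  have h1 := strictConcaveOn_sqrt_one_sub_sq.2 (x := x - d 0) (y := y - c 0)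
    ⟨by linarith, by linarith⟩ ⟨by linarith, by linarith⟩ (by linarith)
    (div_pos (by linarith) hL : 0 < (y - x) / L) (div_pos (by linarith) hL : 0 < (d 0 - c 0) / L)
    (by linarith)
  have h2 := strictConcaveOn_sqrt_one_sub_sq.2 (x := x - d 0) (y := y - c 0)
    ⟨by linarith, by linarith⟩ ⟨by linarith, by linarith⟩ (by linarith)
    (div_pos (by linarith) hL : 0 < (d 0 - c 0) / L) (div_pos (by linarith) hL : 0 < (y - x) / L)
    hs
  simp only [smul_eq_mul] at h1 h2
  have e1 : (y - x) / L * (x - d 0) + (d 0 - c 0) / L * (y - c 0) = x - c 0 := by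
    field_simp
    rw [hLdef]; ring
  have e2 : (d 0 - c 0) / L * (x - d 0) + (y - x) / L * (y - c 0) = y - d 0 := by
    field_simp
    rw [hLdef]; ring
  rw [e1] at h1
  rw [e2] at h2
  unfold semicircle
  have h3 : ((d 0 - c 0) / L + (y - x) / L) * √(1 - (x - d 0) ^ 2) = √(1 - (x - d 0) ^ 2) := by
    rw [hs, one_mul]
  have h4 : ((d 0 - c 0) / L + (y - x) / L) * √(1 - (y - c 0) ^ 2) = √(1 - (y - c 0) ^ 2) := by
    rw [hs, one_mul]
  linarith

/-- An arc of the upper unit semicircle around `center`, given by its end points. -/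
structure UnitArc where
  center : Plane
  left : Plane
  right : Plane

namespace UnitArc

/-- Height of the arc above the abscissa `x`. -/
noncomputable def height (e : UnitArc) (x : ℝ) : ℝ := semicircle e.center x

/-- The arc joins two consecutive points of `S` on its semicircle. -/
structure IsEdge (S : Finset Plane) (e : UnitArc) : Prop where
  left_mem : e.left ∈ S
  right_mem : e.right ∈ S
  lt : e.left 0 < e.right 0
  left_on : OnSemicircle e.center e.left
  right_on : OnSemicircle e.center e.right
  interior : ∀ v ∈ S, e.left 0 < v 0 → v 0 < e.right 0 → v 1 ≠ e.height (v 0)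

/-- On their common range of abscissae, `e` starts strictly below `g` and ends strictly above. -/
def CrossesUp (e g : UnitArc) : Prop :=
  max (e.left 0) (g.left 0) < min (e.right 0) (g.right 0) ∧
  e.height (max (e.left 0) (g.left 0)) < g.height (max (e.left 0) (g.left 0)) ∧
  g.height (min (e.right 0) (g.right 0)) < e.height (min (e.right 0) (g.right 0))

/-- On the common range of abscissae `g` is below `e`, and they meet only at common end points. -/
def Below (g e : UnitArc) : Prop :=
  ∀ x, e.left 0 ≤ x → g.left 0 ≤ x → x ≤ e.right 0 → x ≤ g.right 0 →
    g.height x ≤ e.height x ∧ (g.height x = e.height x →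
      (g.left = e.left ∧ x = e.left 0) ∨ (g.right = e.right ∧ x = e.right 0))

variable {S : Finset Plane} {e g : UnitArc}

lemma IsEdge.mono {T : Finset Plane} (he : e.IsEdge T) (hST : S ⊆ T) (hl : e.left ∈ S)
    (hr : e.right ∈ S) : e.IsEdge S :=
  ⟨hl, hr, he.lt, he.left_on, he.right_on, fun v hv => he.interior v (hST hv)⟩

lemma IsEdge.left_height (he : e.IsEdge S) : e.left 1 = e.height (e.left 0) := he.left_on.2

lemma IsEdge.right_height (he : e.IsEdge S) : e.right 1 = e.height (e.right 0) := he.right_on.2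

lemma IsEdge.abs_le (he : e.IsEdge S) {x : ℝ} (h1 : e.left 0 ≤ x) (h2 : x ≤ e.right 0) :
    |x - e.center 0| ≤ 1 := by
  have h3 := _root_.abs_le.1 he.left_on.1
  have h4 := _root_.abs_le.1 he.right_on.1
  exact _root_.abs_le.2 ⟨by linarith, by linarith⟩

lemma IsEdge.left_eq (he : e.IsEdge S) (hg : g.IsEdge S)
    (h1 : e.left 0 < g.right 0) (h2 : g.left 0 < e.right 0)
    (h : e.height (max (e.left 0) (g.left 0)) = g.height (max (e.left 0) (g.left 0))) :
    e.left = g.left := by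
  rcases lt_trichotomy (e.left 0) (g.left 0) with hlt | heq | hlt
  · rw [max_eq_right hlt.le, ← hg.left_height] at h
    exact absurd h.symm (he.interior _ hg.left_mem hlt h2)
  · rw [heq, max_self, ← hg.left_height, ← heq, ← he.left_height] at h
    exact Plane.ext heq h
  · rw [max_eq_left hlt.le, ← he.left_height] at h
    exact absurd h (hg.interior _ he.left_mem hlt h1)

lemma IsEdge.right_eq (he : e.IsEdge S) (hg : g.IsEdge S)
    (h1 : e.left 0 < g.right 0) (h2 : g.left 0 < e.right 0)
    (h : e.height (min (e.right 0) (g.right 0)) = g.height (min (e.right 0) (g.right 0))) :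
    e.right = g.right := by
  rcases lt_trichotomy (e.right 0) (g.right 0) with hlt | heq | hlt
  · rw [min_eq_left hlt.le, ← he.right_height] at h
    exact absurd h (hg.interior _ he.right_mem h2 hlt)
  · rw [heq, min_self, ← hg.right_height, ← heq, ← he.right_height] at h
    exact Plane.ext heq h
  · rw [min_eq_right hlt.le, ← hg.right_height] at h
    exact absurd h.symm (he.interior _ hg.right_mem h1 hlt)

lemma IsEdge.eq_of_center_eq (he : e.IsEdge S) (hg : g.IsEdge S)
    (h1 : e.left 0 < g.right 0) (h2 : g.left 0 < e.right 0) (hc : e.center = g.center) :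
    e = g := by
  have hl := he.left_eq hg h1 h2 (by simp only [height, hc])
  have hr := he.right_eq hg h1 h2 (by simp only [height, hc])
  cases e
  cases g
  simp_all

lemma below_or_below_aux (he : e.IsEdge S) (hg : g.IsEdge S)
    (h1 : e.left 0 < g.right 0) (h2 : g.left 0 < e.right 0)
    (hlt : e.center 0 < g.center 0) (hn : ¬ g.CrossesUp e) :
    Below g e ∨ Below e g := by
  have hab : max (e.left 0) (g.left 0) < min (e.right 0) (g.right 0) :=
    max_lt (lt_min he.lt h1) (lt_min h2 hg.lt)
  have hD : ∀ x y, max (e.left 0) (g.left 0) ≤ x → x < y → y ≤ min (e.right 0) (g.right 0) →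
      e.height y - g.height y < e.height x - g.height x := by
    intro x y hx hxy hy
    have hx' := max_le_iff.1 hx
    have hy' := le_min_iff.1 hy
    exact semicircle_sub_lt hlt hxy (hg.abs_le hx'.2 (by linarith))
      (he.abs_le (by linarith) hy'.1)
  have key : 0 ≤ e.height (min (e.right 0) (g.right 0)) - g.height (min (e.right 0) (g.right 0)) ∨
      e.height (max (e.left 0) (g.left 0)) - g.height (max (e.left 0) (g.left 0)) ≤ 0 := by
    by_contra! hcon
    refine hn ⟨?_, ?_, ?_⟩
    · rwa [max_comm, min_comm]
    · rw [max_comm]; linarith [hcon.2]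
    · rw [min_comm]; linarith [hcon.1]
  rcases key with hk | hk
  · left
    intro x x1 x2 x3 x4
    rcases (le_min x3 x4).lt_or_eq with hx | hx
    · have := hD x _ (max_le x1 x2) hx le_rfl
      exact ⟨by linarith, fun h => by linarith⟩
    · rw [← hx] at hk
      refine ⟨by linarith, fun h => Or.inr ?_⟩
      have hr := he.right_eq hg h1 h2 (by rw [← hx, h])
      exact ⟨hr.symm, by rw [hx, hr, min_self]⟩
  · right
    intro x x1 x2 x3 x4
    rcases (max_le x2 x1).lt_or_eq with hx | hx
    · have := hD _ x le_rfl hx (le_min x4 x3)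
      exact ⟨by linarith, fun h => by linarith⟩
    · rw [hx] at hk
      refine ⟨by linarith, fun h => Or.inl ?_⟩
      have hl := he.left_eq hg h1 h2 (by rw [hx, h])
      exact ⟨hl, by rw [← hx, hl, max_self]⟩

lemma below_or_below (he : e.IsEdge S) (hg : g.IsEdge S) (hne : e ≠ g)
    (h1 : e.left 0 < g.right 0) (h2 : g.left 0 < e.right 0)
    (hn : ¬ e.CrossesUp g) (hn' : ¬ g.CrossesUp e) :
    Below g e ∨ Below e g := by
  rcases lt_trichotomy (e.center 0) (g.center 0) with hlt | heq | hlt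
  · exact below_or_below_aux he hg h1 h2 hlt hn'
  · have hc : e.center 1 ≠ g.center 1 := fun hc =>
      hne (he.eq_of_center_eq hg h1 h2 (Plane.ext heq hc))
    rcases lt_or_gt_of_ne hc with hc | hc
    · right
      intro x _ _ _ _
      simp only [height, semicircle, heq]
      exact ⟨by linarith, fun h => by linarith⟩
    · left
      intro x _ _ _ _
      simp only [height, semicircle, heq]
      exact ⟨by linarith, fun h => by linarith⟩
  · exact (below_or_below_aux hg he h2 h1 hlt hn).symm

lemma IsEdge.eq_of_ends_eq (he : e.IsEdge S) (hg : g.IsEdge S) (hl : e.left = g.left)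
    (hr : e.right = g.right) : e = g := by
  have a1 := he.left_height
  have a2 := hg.left_height
  have a3 := he.right_height
  have a4 := hg.right_height
  have e1 := he.abs_le le_rfl he.lt.le
  have e2 := he.abs_le he.lt.le le_rfl
  have g1 := hg.abs_le le_rfl hg.lt.le
  have g2 := hg.abs_le hg.lt.le le_rfl
  rw [← hl] at a2 g1
  rw [← hr] at a4 g2
  by_contra hne
  rcases lt_trichotomy (e.center 0) (g.center 0) with hlt | heq | hlt
  · have := semicircle_sub_lt hlt he.lt g1 e2
    simp only [height] at *
    linarith
  · refine hne (he.eq_of_center_eq hg (by rw [← hr]; exact he.lt) (by rw [← hl]; exact he.lt)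
      (Plane.ext heq ?_))
    simp only [height, semicircle, heq] at *
    linarith
  · have := semicircle_sub_lt hlt he.lt e1 g2
    simp only [height] at *
    linarith


/-- The point `v` is strictly below the interior of `e`, with no arc of `E` passing in between. -/
def LowestAbove (E : Finset UnitArc) (v : Plane) (e : UnitArc) : Prop :=
  e.left 0 < v 0 ∧ v 0 < e.right 0 ∧ v 1 < e.height (v 0) ∧
    ∀ h ∈ E, h.left 0 ≤ v 0 → v 0 ≤ h.right 0 → v 1 < h.height (v 0) →
      e.height (v 0) ≤ h.height (v 0)

lemma exists_next_below {E : Finset UnitArc} (hE : ∀ e ∈ E, e.IsEdge S)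
    (h : ∃ g ∈ E, g.left = e.left ∧ g ≠ e ∧ Below g e) :
    ∃ g ∈ E, g.left = e.left ∧ g ≠ e ∧ Below g e ∧
      ∀ k ∈ E, k.left = e.left → k ≠ e → Below k e → k ≠ g → ¬ Below g k := by
  classical
  obtain ⟨g₁, hg₁, hl₁, hne₁, hb₁⟩ := h
  obtain ⟨k₀, hk₀, hmin⟩ := (E.filter fun g => g.left = e.left).exists_min_image
    (fun g => g.right 0) ⟨g₁, by simp [hg₁, hl₁]⟩
  obtain ⟨g, hg, hmax⟩ := (E.filter fun g => g.left = e.left ∧ g ≠ e ∧ Below g e).exists_max_image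
    (fun g => g.height (k₀.right 0)) ⟨g₁, by simp [hg₁, hl₁, hne₁, hb₁]⟩
  simp only [Finset.mem_filter] at hk₀ hmin hg hmax
  refine ⟨g, hg.1, hg.2.1, hg.2.2.1, hg.2.2.2, fun k hk hkl hke hkb hkg hgk => ?_⟩
  have hlt := (hE k₀ hk₀.1).lt
  rw [hk₀.2] at hlt
  have h1 := hmax k ⟨hk, hkl, hke, hkb⟩
  have h2 := hgk (k₀.right 0) (by rw [hkl]; exact hlt.le) (by rw [hg.2.1]; exact hlt.le)
    (hmin k ⟨hk, hkl⟩) (hmin g ⟨hg.1, hg.2.1⟩)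
  rcases h2.2 (le_antisymm h2.1 h1) with h3 | h3
  · rw [hkl] at h3
    exact hlt.ne' h3.2
  · exact hkg ((hE k hk).eq_of_ends_eq (hE g hg.1) (hkl.trans hg.2.1.symm) h3.1.symm)

lemma charge {E : Finset UnitArc} (hE : ∀ e ∈ E, e.IsEdge S)
    (hn : ∀ e ∈ E, ∀ g ∈ E, ¬ e.CrossesUp g) (he : e ∈ E) :
    (∀ g ∈ E, g.left = e.left → g ≠ e → ¬ Below g e) ∨
    (∀ g ∈ E, g.right = e.right → g ≠ e → ¬ Below g e) ∨
    ∃ v ∈ S, LowestAbove E v e := by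
  classical
  rw [or_iff_not_imp_left, or_iff_not_imp_left]
  intro hl hr
  push Not at hl hr
  obtain ⟨g, hg, hgl, hge, hgb, hgmax⟩ := exists_next_below hE hl
  obtain ⟨k, hk, hkr, hke, hkb⟩ := hr
  have He := hE e he
  have Hg := hE g hg
  have Hk := hE k hk
  have hlg : g.left 0 = e.left 0 := by rw [hgl]
  have hrk : k.right 0 = e.right 0 := by rw [hkr]
  have Helt := He.lt
  have Hglt := Hg.lt
  have Hklt := Hk.lt
  -- the points between `g` and `e`
  set W := S.filter fun v => e.left 0 < v 0 ∧ v 0 < e.right 0 ∧ v 1 < e.height (v 0) ∧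
    v 0 ≤ g.right 0 ∧ g.height (v 0) ≤ v 1 with hW
  have hWne : W.Nonempty := by
    rcases lt_or_ge (g.right 0) (e.right 0) with hlt | hge'
    · refine ⟨g.right, ?_⟩
      simp only [hW, Finset.mem_filter]
      refine ⟨Hg.right_mem, by linarith, hlt, ?_, le_rfl, Hg.right_height.ge⟩
      have h1 := hgb (g.right 0) (by linarith) Hg.lt.le hlt.le le_rfl
      rw [Hg.right_height]
      refine lt_of_le_of_ne h1.1 fun h => ?_
      rcases h1.2 h with h2 | h2
      · linarith [h2.2]
      · linarith [h2.2]
    · refine ⟨k.left, ?_⟩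
      have hgk : g ≠ k := by
        rintro rfl
        exact hge (Hg.eq_of_ends_eq He hgl hkr)
      have hgk' : Below g k := by
        rcases below_or_below Hg Hk hgk (by linarith) (by linarith) (hn _ hg _ hk)
          (hn _ hk _ hg) with h | h
        · have h1 := h (e.right 0) (by linarith) (by linarith) hge' hrk.ge
          have h2 := hgb (e.right 0) (by linarith) (by linarith) le_rfl hge'
          have h3 : k.height (e.right 0) = e.height (e.right 0) := by
            rw [← He.right_height, ← hkr, Hk.right_height]
          rcases h2.2 (le_antisymm h2.1 (h3 ▸ h1.1)) with h4 | h4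
          · linarith [h4.2]
          · exact absurd (Hg.eq_of_ends_eq He hgl h4.1) hge
        · exact h
      have hlt : e.left 0 < k.left 0 := by
        by_contra! hle
        have h1 := hgk' (e.left 0) hle hlg.le (by linarith) (by linarith)
        have h2 := hkb (e.left 0) le_rfl hle (by linarith) (by linarith)
        have h3 : g.height (e.left 0) = e.height (e.left 0) := by
          rw [← He.left_height, ← hgl, Hg.left_height]
        rcases h2.2 (le_antisymm h2.1 (h3 ▸ h1.1)) with h4 | h4
        · exact hke (Hk.eq_of_ends_eq He h4.1 hkr)
        · linarith [h4.2]
      simp only [hW, Finset.mem_filter]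
      refine ⟨Hk.left_mem, hlt, by linarith, ?_, by linarith, ?_⟩
      · have h1 := hkb (k.left 0) hlt.le le_rfl (by linarith) (by linarith)
        rw [Hk.left_height]
        refine lt_of_le_of_ne h1.1 fun h => ?_
        rcases h1.2 h with h2 | h2
        · linarith [h2.2]
        · linarith [h2.2]
      · rw [Hk.left_height]
        exact (hgk' (k.left 0) le_rfl (by linarith) (by linarith) (by linarith)).1
  obtain ⟨v, hv, hmin⟩ := W.exists_min_image (fun v => toLex (v 0, -v 1)) hWne
  simp only [hW, Finset.mem_filter, Prod.Lex.toLex_le_toLex] at hv hmin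
  obtain ⟨hvS, hv1, hv2, hv3, hv4, hv5⟩ := hv
  refine ⟨v, hvS, hv1, hv2, hv3, fun h hh hh1 hh2 hh3 => ?_⟩
  by_contra! hh4
  have Hh := hE h hh
  have Hhlt := Hh.lt
  have hhe : h ≠ e := by
    rintro rfl
    exact lt_irrefl _ hh4
  have hhg : g ≠ h := by
    rintro rfl
    linarith
  have hhb : Below h e := by
    rcases below_or_below He Hh hhe.symm (by linarith) (by linarith) (hn _ he _ hh)
      (hn _ hh _ he) with h1 | h1
    · exact h1
    · linarith [(h1 (v 0) hh1 hv1.le hh2 hv2.le).1]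
  have hlh : e.left 0 ≤ h.left 0 → h.left 1 < e.height (h.left 0) ∨ h.left = e.left := by
    intro hle
    have h1 := hhb (h.left 0) hle le_rfl (by linarith) (by linarith)
    rw [Hh.left_height]
    rcases h1.1.lt_or_eq with h2 | h2
    · exact Or.inl h2
    · rcases h1.2 h2 with h3 | h3
      · exact Or.inr h3.1
      · linarith [h3.2]
  rcases hh1.lt_or_eq with hlt | heq
  · have hgh : Below g h := by
      rcases below_or_below Hg Hh hhg (by linarith) (by linarith) (hn _ hg _ hh)
        (hn _ hh _ hg) with h1 | h1
      · linarith [(h1 (v 0) (by linarith) hh1 hv4 hh2).1]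
      · exact h1
    rcases lt_or_ge (e.left 0) (h.left 0) with h1 | h1
    · have h2 : h.left 1 < e.height (h.left 0) := by
        rcases hlh h1.le with h2 | h2
        · exact h2
        · rw [h2] at h1
          exact absurd h1 (lt_irrefl _)
      have h3 := (hgh (h.left 0) le_rfl (by linarith) (by linarith) (by linarith)).1
      rcases hmin h.left ⟨Hh.left_mem, h1, by linarith, h2, by linarith,
        by rw [Hh.left_height]; exact h3⟩ with h4 | h4
      · linarith
      · linarith [h4.1]
    · have h2 := hgh (e.left 0) h1 hlg.le (by linarith) (by linarith)
      have h3 := hhb (e.left 0) le_rfl h1 (by linarith) (by linarith)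
      have h4 : g.height (e.left 0) = e.height (e.left 0) := by
        rw [← He.left_height, ← hgl, Hg.left_height]
      rcases h3.2 (le_antisymm h3.1 (h4 ▸ h2.1)) with h5 | h5
      · exact hgmax h hh h5.1 hhe hhb hhg.symm hgh
      · linarith [h5.2]
  · have h2 : h.left 1 < e.height (h.left 0) := by
      rw [Hh.left_height, heq]
      exact hh4
    have h3 : v 1 < h.left 1 := by
      rw [Hh.left_height, heq]
      exact hh3
    rcases hmin h.left ⟨Hh.left_mem, by linarith, by linarith, h2, by linarith,
      by rw [heq]; linarith⟩ with h4 | h4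
    · linarith
    · linarith [h4.2]

lemma card_le_of_noncrossing {E : Finset UnitArc} (hE : ∀ e ∈ E, e.IsEdge S)
    (hn : ∀ e ∈ E, ∀ g ∈ E, ¬ e.CrossesUp g) : E.card ≤ 3 * S.card := by
  classical
  set A := E.filter fun e => ∀ g ∈ E, g.left = e.left → g ≠ e → ¬ Below g e with hA
  set B := E.filter fun e => ∀ g ∈ E, g.right = e.right → g ≠ e → ¬ Below g e with hB
  set C := E.filter fun e => ∃ v ∈ S, LowestAbove E v e with hC
  have hABC : E ⊆ A ∪ (B ∪ C) := by
    intro e he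
    simp only [hA, hB, hC, Finset.mem_union, Finset.mem_filter]
    rcases charge hE hn he with h | h | h
    · exact Or.inl ⟨he, h⟩
    · exact Or.inr (Or.inl ⟨he, h⟩)
    · exact Or.inr (Or.inr ⟨he, h⟩)
  have hAc : A.card ≤ S.card := by
    refine Finset.card_le_card_of_injOn left
      (fun e he => (hE e (Finset.mem_filter.1 he).1).left_mem) ?_
    intro e he g hg heg
    obtain ⟨he, he'⟩ := Finset.mem_filter.1 he
    obtain ⟨hg, hg'⟩ := Finset.mem_filter.1 hg
    by_contra hne
    have h1 := (hE e he).lt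
    have h2 := (hE g hg).lt
    rcases below_or_below (hE e he) (hE g hg) hne (by rw [heg]; exact h2) (by rw [← heg]; exact h1)
      (hn _ he _ hg) (hn _ hg _ he) with h | h
    · exact he' g hg heg.symm (Ne.symm hne) h
    · exact hg' e he heg hne h
  have hBc : B.card ≤ S.card := by
    refine Finset.card_le_card_of_injOn right
      (fun e he => (hE e (Finset.mem_filter.1 he).1).right_mem) ?_
    intro e he g hg heg
    obtain ⟨he, he'⟩ := Finset.mem_filter.1 he
    obtain ⟨hg, hg'⟩ := Finset.mem_filter.1 hg
    by_contra hne
    have h1 := (hE e he).lt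
    have h2 := (hE g hg).lt
    rcases below_or_below (hE e he) (hE g hg) hne (by rw [← heg]; exact h1) (by rw [heg]; exact h2)
      (hn _ he _ hg) (hn _ hg _ he) with h | h
    · exact he' g hg heg.symm (Ne.symm hne) h
    · exact hg' e he heg hne h
  have hCc : C.card ≤ S.card := by
    have hex : ∀ e : UnitArc, ∃ v, e ∈ C → v ∈ S ∧ LowestAbove E v e := by
      intro e
      by_cases he : e ∈ C
      · obtain ⟨v, hv⟩ := (Finset.mem_filter.1 he).2
        exact ⟨v, fun _ => hv⟩
      · exact ⟨0, fun h => absurd h he⟩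
    choose φ hφ using hex
    refine Finset.card_le_card_of_injOn φ (fun e he => (hφ e he).1) ?_
    intro e he g hg heg
    obtain ⟨_, e1, e2, e3, e4⟩ := hφ e he
    obtain ⟨_, g1, g2, g3, g4⟩ := hφ g hg
    rw [← heg] at g1 g2 g3 g4
    replace he := (Finset.mem_filter.1 he).1
    replace hg := (Finset.mem_filter.1 hg).1
    have heq := le_antisymm (e4 g hg g1.le g2.le g3) (g4 e he e1.le e2.le e3)
    by_contra hne
    rcases below_or_below (hE e he) (hE g hg) hne (by linarith) (by linarith)
      (hn _ he _ hg) (hn _ hg _ he) with h | h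
    · rcases (h _ e1.le g1.le e2.le g2.le).2 heq.symm with h | h <;> linarith [h.2]
    · rcases (h _ g1.le e1.le g2.le e2.le).2 heq with h | h <;> linarith [h.2]
  have h1 := Finset.card_le_card hABC
  have h2 := Finset.card_union_le A (B ∪ C)
  have h3 := Finset.card_union_le B C
  omega

open Classical in
/-- The ordered pairs of arcs of `E` such that the first crosses the second upwards. -/
noncomputable def crossings (E : Finset UnitArc) : Finset (UnitArc × UnitArc) :=
  (E ×ˢ E).filter fun q => q.1.CrossesUp q.2

lemma mem_crossings {E : Finset UnitArc} {q : UnitArc × UnitArc} :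
    q ∈ crossings E ↔ q.1 ∈ E ∧ q.2 ∈ E ∧ q.1.CrossesUp q.2 := by
  simp [crossings, and_assoc]

lemma card_le_add_crossings {E : Finset UnitArc} (hE : ∀ e ∈ E, e.IsEdge S) :
    E.card ≤ 3 * S.card + (crossings E).card := by
  classical
  have h1 : (E \ (crossings E).image Prod.fst).card ≤ 3 * S.card := by
    refine card_le_of_noncrossing (fun e he => hE e (Finset.mem_sdiff.1 he).1) ?_
    intro e he g hg hc
    rw [Finset.mem_sdiff] at he hg
    exact he.2 (Finset.mem_image.2 ⟨(e, g), mem_crossings.2 ⟨he.1, hg.1, hc⟩, rfl⟩)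
  have h2 := Finset.le_card_sdiff ((crossings E).image Prod.fst) E
  have h3 := Finset.card_image_le (s := crossings E) (f := Prod.fst)
  omega

lemma CrossesUp.center_lt (he : e.IsEdge S) (hg : g.IsEdge S) (h : e.CrossesUp g) :
    g.center 0 < e.center 0 := by
  obtain ⟨h1, h2, h3⟩ := h
  obtain ⟨h4, h5⟩ := lt_min_iff.1 h1
  rcases lt_trichotomy (e.center 0) (g.center 0) with hlt | heq | hlt
  · have := semicircle_sub_lt hlt h1
      (hg.abs_le (le_max_right _ _) h5.le)
      (he.abs_le ((le_max_left _ _).trans h1.le) (min_le_left _ _))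
    simp only [height] at *
    linarith
  · simp only [height, semicircle, heq] at *
    linarith
  · exact hlt

lemma crossings_injOn {E : Finset UnitArc} (hE : ∀ e ∈ E, e.IsEdge S) :
    Set.InjOn (fun q : UnitArc × UnitArc => (q.1.center, q.2.center)) (crossings E) := by
  rintro ⟨e, g⟩ h ⟨e', g'⟩ h' heq
  simp only [Finset.mem_coe, mem_crossings] at h h'
  simp only [Prod.mk.injEq] at heq
  obtain ⟨he, hg, hc⟩ := h
  obtain ⟨he', hg', hc'⟩ := h'
  have hlt := CrossesUp.center_lt (hE e he) (hE g hg) hc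
  -- the zone of the first crossing does not precede that of the second one
  have key : ∀ e g e' g' : UnitArc, e.IsEdge S → g.IsEdge S → e'.IsEdge S → g'.IsEdge S →
      e.CrossesUp g → e'.CrossesUp g' → e.center = e'.center → g.center = g'.center →
      max (e'.left 0) (g'.left 0) < min (e.right 0) (g.right 0) := by
    intro e g e' g' He Hg He' Hg' hc hc' hee hgg
    by_contra! hle
    have hlt := CrossesUp.center_lt He Hg hc
    obtain ⟨h1, h2, h3⟩ := hc
    obtain ⟨h1', h2', h3'⟩ := hc'
    obtain ⟨h4, h5⟩ := max_lt_iff.1 h1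
    obtain ⟨h4', h5'⟩ := lt_min_iff.1 h1'
    simp only [height, ← hee, ← hgg] at h2' h3' h3
    rcases hle.lt_or_eq with hlt' | heq'
    · have hx := He.abs_le h4.le (min_le_left _ _)
      have hy := Hg'.abs_le (le_max_right (e'.left 0) (g'.left 0)) h5'.le
      rw [← hgg] at hy
      have := semicircle_sub_lt hlt hlt' hx hy
      linarith
    · rw [heq'] at h3
      linarith
  have k1 := key e g e' g' (hE e he) (hE g hg) (hE e' he') (hE g' hg') hc hc' heq.1 heq.2
  have k2 := key e' g' e g (hE e' he') (hE g' hg') (hE e he) (hE g hg) hc' hc heq.1.symm heq.2.symm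
  simp only [lt_min_iff, max_lt_iff] at k1 k2
  rw [Prod.mk.injEq]
  exact ⟨(hE e he).eq_of_center_eq (hE e' he') k2.1.1 k1.1.1 heq.1,
    (hE g hg).eq_of_center_eq (hE g' hg') k2.2.2 k1.2.2 heq.2⟩

lemma CrossesUp.card_ends [DecidableEq Plane] (he : e.IsEdge S) (hg : g.IsEdge S)
    (h : e.CrossesUp g) :
    ({e.left, e.right, g.left, g.right} : Finset Plane).card = 4 := by
  obtain ⟨h1, h2, h3⟩ := h
  have h1' := lt_min_iff.1 h1
  have h4 := max_lt_iff.1 h1'.1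
  have h5 := max_lt_iff.1 h1'.2
  have hel := he.lt
  have hgl := hg.lt
  have n1 : e.left ≠ e.right := fun h => by rw [h] at hel; exact lt_irrefl _ hel
  have n2 : g.left ≠ g.right := fun h => by rw [h] at hgl; exact lt_irrefl _ hgl
  have n3 : e.left ≠ g.right := fun h => by rw [h] at h5; exact lt_irrefl _ h5.1
  have n4 : e.right ≠ g.left := fun h => by rw [h] at h4; exact lt_irrefl _ h4.2
  have n5 : e.left ≠ g.left := fun h => by
    rw [h, max_self, ← hg.left_height, ← h, ← he.left_height] at h2
    exact lt_irrefl _ h2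
  have n6 : e.right ≠ g.right := fun h => by
    rw [h, min_self, ← hg.right_height, ← h, ← he.right_height] at h3
    exact lt_irrefl _ h3
  rw [Finset.card_insert_of_notMem (by simp [n1, n3, n5]),
    Finset.card_insert_of_notMem (by simp [n4, n6]), Finset.card_pair n2]

end UnitArc

lemma sum_powerset_weight {α : Type*} [DecidableEq α] {A P : Finset α} (hA : A ⊆ P) (p : ℝ) :
    ∑ S ∈ P.powerset, p ^ S.card * (1 - p) ^ (P.card - S.card) * (if A ⊆ S then 1 else 0) =
      p ^ A.card := by
  have h := Finset.prod_add (fun _ : α => p) (fun i => if i ∈ A then 0 else 1 - p) P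
  have h1 : ∏ i ∈ P, (p + if i ∈ A then 0 else 1 - p) = p ^ A.card := by
    have h2 : ∀ i ∈ P, (p + if i ∈ A then 0 else 1 - p) = if i ∈ A then p else 1 := by
      intro i _
      split_ifs <;> ring
    rw [Finset.prod_congr rfl h2, Finset.prod_ite_mem, Finset.inter_eq_right.2 hA,
      Finset.prod_const]
  rw [← h1, h]
  refine Finset.sum_congr rfl fun S hS => ?_
  rw [Finset.mem_powerset] at hS
  rw [Finset.prod_const, mul_assoc]
  congr 1
  split_ifs with hAS
  · have h2 : ∀ i ∈ P \ S, (if i ∈ A then 0 else 1 - p) = 1 - p := fun i hi =>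
      if_neg fun hiA => (Finset.mem_sdiff.1 hi).2 (hAS hiA)
    rw [Finset.prod_congr rfl h2, Finset.prod_const, Finset.card_sdiff_of_subset hS, mul_one]
  · obtain ⟨i, hiA, hiS⟩ := Finset.not_subset.1 hAS
    rw [mul_zero]
    symm
    apply Finset.prod_eq_zero (Finset.mem_sdiff.2 ⟨hA hiA, hiS⟩)
    exact if_pos hiA

lemma sum_powerset_weight_card {α β : Type*} [DecidableEq α] {P : Finset α} (T : Finset β)
    (A : β → Finset α) {k : ℕ} (hA : ∀ t ∈ T, A t ⊆ P) (hk : ∀ t ∈ T, (A t).card = k) (p : ℝ) :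
    ∑ S ∈ P.powerset, p ^ S.card * (1 - p) ^ (P.card - S.card) *
      ((T.filter fun t => A t ⊆ S).card : ℝ) = p ^ k * T.card := by
  simp only [Finset.card_filter, Nat.cast_sum, Finset.mul_sum]
  rw [Finset.sum_comm]
  have h : ∀ t ∈ T, ∑ S ∈ P.powerset, p ^ S.card * (1 - p) ^ (P.card - S.card) *
      (((if A t ⊆ S then 1 else 0 : ℕ)) : ℝ) = p ^ k := by
    intro t ht
    rw [← hk t ht, ← sum_powerset_weight (hA t ht) p]
    simp
  rw [Finset.sum_congr rfl h, Finset.sum_const, nsmul_eq_mul, mul_comm]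

open UnitArc

lemma sampling_inequality {P : Finset Plane} {E : Finset UnitArc} (hE : ∀ e ∈ E, e.IsEdge P)
    {p : ℝ} (hp0 : 0 ≤ p) (hp1 : p ≤ 1) :
    p ^ 2 * E.card ≤ 3 * (p * P.card) + p ^ 4 * (crossings E).card := by
  classical
  have h1 := sum_powerset_weight_card E (fun e => {e.left, e.right}) (P := P) (k := 2)
    (fun e he => Finset.insert_subset (hE e he).left_mem
      (Finset.singleton_subset_iff.2 (hE e he).right_mem))
    (fun e he => Finset.card_pair fun h => by
      have := (hE e he).lt
      rw [h] at this
      exact lt_irrefl _ this) p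
  have h2 := sum_powerset_weight_card P (fun v => {v}) (P := P) (k := 1)
    (fun v hv => Finset.singleton_subset_iff.2 hv) (fun v _ => Finset.card_singleton v) p
  have h3 := sum_powerset_weight_card (crossings E)
    (fun q => {q.1.left, q.1.right, q.2.left, q.2.right}) (P := P) (k := 4)
    (fun q hq => by
      have hq := mem_crossings.1 hq
      intro v hv
      simp only [Finset.mem_insert, Finset.mem_singleton] at hv
      rcases hv with rfl | rfl | rfl | rfl
      · exact (hE _ hq.1).left_mem
      · exact (hE _ hq.1).right_mem
      · exact (hE _ hq.2.1).left_mem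
      · exact (hE _ hq.2.1).right_mem)
    (fun q hq => by
      have hq := mem_crossings.1 hq
      exact hq.2.2.card_ends (hE _ hq.1) (hE _ hq.2.1)) p
  rw [pow_one] at h2
  rw [← h1, ← h2, ← h3, Finset.mul_sum, ← Finset.sum_add_distrib]
  refine Finset.sum_le_sum fun S hS => ?_
  rw [Finset.mem_powerset] at hS
  have hcard : (E.filter fun e => {e.left, e.right} ⊆ S).card ≤
      3 * (P.filter fun v => {v} ⊆ S).card + ((crossings E).filter fun q =>
        {q.1.left, q.1.right, q.2.left, q.2.right} ⊆ S).card := by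
    have hS' : (P.filter fun v => {v} ⊆ S) = S := by
      ext v
      simp only [Finset.mem_filter, Finset.singleton_subset_iff]
      exact ⟨fun h => h.2, fun h => ⟨hS h, h⟩⟩
    have hX : crossings (E.filter fun e => {e.left, e.right} ⊆ S) = (crossings E).filter fun q =>
        {q.1.left, q.1.right, q.2.left, q.2.right} ⊆ S := by
      ext q
      simp only [mem_crossings, Finset.mem_filter, Finset.insert_subset_iff,
        Finset.singleton_subset_iff]
      tauto
    rw [hS', ← hX]
    refine card_le_add_crossings fun e he => ?_
    simp only [Finset.mem_filter, Finset.insert_subset_iff, Finset.singleton_subset_iff] at he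
    exact (hE e he.1).mono hS he.2.1 he.2.2
  have hw : 0 ≤ p ^ S.card * (1 - p) ^ (P.card - S.card) :=
    mul_nonneg (pow_nonneg hp0 _) (pow_nonneg (by linarith) _)
  have hcard' : ((E.filter fun e => {e.left, e.right} ⊆ S).card : ℝ) ≤
      3 * ((P.filter fun v => {v} ⊆ S).card : ℝ) + (((crossings E).filter fun q =>
        {q.1.left, q.1.right, q.2.left, q.2.right} ⊆ S).card : ℝ) := by
    exact_mod_cast hcard
  calc _ ≤ _ := mul_le_mul_of_nonneg_left hcard' hw
    _ = _ := by ring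

/-- The crossing number inequality for graphs drawn with arcs of upper unit semicircles. -/
lemma crossing_inequality {P : Finset Plane} {E : Finset UnitArc} (hE : ∀ e ∈ E, e.IsEdge P)
    (hP : 0 < P.card) (h : 4 * P.card ≤ E.card) :
    (E.card : ℝ) ^ 3 ≤ 64 * (P.card : ℝ) ^ 2 * (crossings E).card := by
  have hn : (0 : ℝ) < P.card := by exact_mod_cast hP
  have hle : 4 * (P.card : ℝ) ≤ E.card := by exact_mod_cast h
  have hm : (0 : ℝ) < E.card := by linarith
  have hs := sampling_inequality hE (p := 4 * P.card / E.card) (by positivity)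
    ((div_le_one hm).2 hle)
  set n := (P.card : ℝ)
  set m := (E.card : ℝ)
  set x := ((crossings E).card : ℝ)
  have h1 : (4 * n / m) ^ 2 * m = 16 * n ^ 2 / m := by field_simp; ring
  have h2 : 3 * (4 * n / m * n) = 12 * n ^ 2 / m := by field_simp; ring
  have h3 : (4 * n / m) ^ 4 * x = 256 * n ^ 4 * x / m ^ 4 := by field_simp; ring
  rw [h1, h2, h3] at hs
  have h4 : 4 * n ^ 2 / m ≤ 256 * n ^ 4 * x / m ^ 4 := by
    have : 16 * n ^ 2 / m = 12 * n ^ 2 / m + 4 * n ^ 2 / m := by ring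
    linarith
  rw [div_le_div_iff₀ hm (by positivity)] at h4
  have h5 : 4 * n ^ 2 * m * m ^ 3 ≤ 4 * n ^ 2 * m * (64 * n ^ 2 * x) := by nlinarith
  exact le_of_mul_le_mul_left h5 (by positivity)

open Classical in
/-- The arcs between consecutive points of `P` on the upper unit semicircles around points
of `P`. -/
noncomputable def unitArcs (P : Finset Plane) : Finset UnitArc :=
  ((P ×ˢ P ×ˢ P).image fun t => UnitArc.mk t.1 t.2.1 t.2.2).filter fun e => e.IsEdge P

lemma mem_unitArcs {P : Finset Plane} {e : UnitArc} :
    e ∈ unitArcs P ↔ e.center ∈ P ∧ e.IsEdge P := by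
  classical
  simp only [unitArcs, Finset.mem_filter, Finset.mem_image, Finset.mem_product]
  constructor
  · rintro ⟨⟨t, ht, rfl⟩, he⟩
    exact ⟨ht.1, he⟩
  · rintro ⟨hc, he⟩
    exact ⟨⟨(e.center, e.left, e.right), ⟨hc, he.left_mem, he.right_mem⟩, rfl⟩, he⟩

lemma card_crossings_unitArcs_le (P : Finset Plane) :
    (crossings (unitArcs P)).card ≤ P.card * P.card - P.card := by
  classical
  rw [← Finset.offDiag_card]
  refine Finset.card_le_card_of_injOn _ (fun q hq => ?_)
    (crossings_injOn fun e he => (mem_unitArcs.1 he).2)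
  have hq := mem_crossings.1 hq
  have h1 := mem_unitArcs.1 hq.1
  have h2 := mem_unitArcs.1 hq.2.1
  refine Finset.mem_coe.2 (Finset.mem_offDiag.2 ⟨h1.1, h2.1, fun h => ?_⟩)
  have := hq.2.2.center_lt h1.2 h2.2
  exact this.ne' (congrArg (fun c : Plane => c 0) h)

/-- `p` lies at distance one from `c` and above it, ties being broken by the abscissa. -/
def UnitAbove (c p : Plane) : Prop :=
  dist c p = 1 ∧ (c 1 < p 1 ∨ c 1 = p 1 ∧ c 0 < p 0)

lemma UnitAbove.onSemicircle {c p : Plane} (h : UnitAbove c p) : OnSemicircle c p := by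
  obtain ⟨hd, h⟩ := h
  rw [EuclideanSpace.dist_eq, Real.sqrt_eq_one, Fin.sum_univ_two, Real.dist_eq, Real.dist_eq,
    sq_abs, sq_abs] at hd
  have hle : c 1 ≤ p 1 := h.elim le_of_lt fun h => h.1.le
  refine ⟨(sq_le_one_iff_abs_le_one _).1 (by nlinarith [sq_nonneg (c 1 - p 1)]), ?_⟩
  rw [semicircle, show 1 - (p 0 - c 0) ^ 2 = (p 1 - c 1) ^ 2 by linarith,
    Real.sqrt_sq (by linarith)]
  ring

lemma unitAbove_of_onSemicircle {c p : Plane} (h : OnSemicircle c p) (hlt : |p 0 - c 0| < 1) :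
    UnitAbove c p := by
  have h1 : 0 < 1 - (p 0 - c 0) ^ 2 := by
    have := (sq_lt_one_iff_abs_lt_one (p 0 - c 0)).2 hlt
    linarith
  have h2 := h.2
  rw [semicircle] at h2
  have h3 := Real.sqrt_pos.2 h1
  refine ⟨?_, Or.inl (by linarith)⟩
  rw [EuclideanSpace.dist_eq, Real.sqrt_eq_one, Fin.sum_univ_two, Real.dist_eq, Real.dist_eq,
    sq_abs, sq_abs]
  have h4 := Real.sq_sqrt h1.le
  rw [show √(1 - (p 0 - c 0) ^ 2) = p 1 - c 1 by linarith] at h4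
  linarith

lemma exists_unitArc_of_unitAbove {P : Finset Plane} {c p q : Plane} (hc : c ∈ P) (hp : p ∈ P)
    (hq : q ∈ P) (hcp : UnitAbove c p) (hcq : UnitAbove c q) (hpq : p 0 < q 0) :
    ∃ e ∈ unitArcs P, e.center = c ∧ e.left = p := by
  classical
  obtain ⟨r, hr, hmin⟩ := (P.filter fun v => UnitAbove c v ∧ p 0 < v 0).exists_min_image
    (fun v => v 0) ⟨q, by simp [hq, hcq, hpq]⟩
  simp only [Finset.mem_filter] at hr hmin
  refine ⟨⟨c, p, r⟩, mem_unitArcs.2 ⟨hc, hp, hr.1, hr.2.2, hcp.onSemicircle,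
    hr.2.1.onSemicircle, fun v hv h1 h2 h3 => ?_⟩, rfl, rfl⟩
  simp only [height] at h1 h2 h3
  have h4 := abs_le.1 hcp.onSemicircle.1
  have h5 := abs_le.1 hr.2.1.onSemicircle.1
  have h6 : |v 0 - c 0| < 1 := abs_lt.2 ⟨by linarith, by linarith⟩
  have h7 := hmin v ⟨hv, unitAbove_of_onSemicircle ⟨h6.le, h3⟩ h6, h1⟩
  linarith

open Classical in
/-- The pairs `(c, p)` of points of `P` with `UnitAbove c p`. -/
noncomputable def unitIncidences (P : Finset Plane) : Finset (Plane × Plane) :=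
  (P ×ˢ P).filter fun t => UnitAbove t.1 t.2

lemma mem_unitIncidences {P : Finset Plane} {t : Plane × Plane} :
    t ∈ unitIncidences P ↔ t.1 ∈ P ∧ t.2 ∈ P ∧ UnitAbove t.1 t.2 := by
  simp [unitIncidences, and_assoc]

lemma card_unitIncidences_le (P : Finset Plane) :
    (unitIncidences P).card ≤ (unitArcs P).card + P.card := by
  classical
  set A := (unitIncidences P).filter fun t => ∃ q ∈ P, UnitAbove t.1 q ∧ t.2 0 < q 0 with hA
  set B := (unitIncidences P).filter fun t => ¬ ∃ q ∈ P, UnitAbove t.1 q ∧ t.2 0 < q 0 with hB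
  have hAB : A.card + B.card = (unitIncidences P).card := Finset.card_filter_add_card_filter_not _
  have hAc : A.card ≤ (unitArcs P).card := by
    refine le_trans (Finset.card_le_card ?_)
      (Finset.card_image_le (s := unitArcs P) (f := fun e => (e.center, e.left)))
    intro t ht
    obtain ⟨ht, q, hq, hcq, hlt⟩ := Finset.mem_filter.1 ht
    obtain ⟨h1, h2, h3⟩ := mem_unitIncidences.1 ht
    obtain ⟨e, he, hec, hel⟩ := exists_unitArc_of_unitAbove h1 h2 hq h3 hcq hlt
    exact Finset.mem_image.2 ⟨e, he, by rw [hec, hel]⟩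
  have hBc : B.card ≤ P.card := by
    refine Finset.card_le_card_of_injOn Prod.fst
      (fun t ht => (mem_unitIncidences.1 (Finset.mem_filter.1 ht).1).1) ?_
    rintro ⟨c, p⟩ ht ⟨c', q⟩ ht' (rfl : c = c')
    obtain ⟨ht, hmax⟩ := Finset.mem_filter.1 ht
    obtain ⟨ht', hmax'⟩ := Finset.mem_filter.1 ht'
    obtain ⟨_, hp, hcp⟩ := mem_unitIncidences.1 ht
    obtain ⟨_, hq, hcq⟩ := mem_unitIncidences.1 ht'
    push Not at hmax hmax'
    have h0 : p 0 = q 0 := le_antisymm (hmax' p hp hcp) (hmax q hq hcq)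
    have h1 : p 1 = q 1 := by
      rw [hcp.onSemicircle.2, hcq.onSemicircle.2]
      simp only [h0]
    rw [Plane.ext h0 h1]
  omega

lemma ncard_unitDistancePairs_le (P : Finset Plane) :
    Set.ncard {s : Sym2 Plane | ∃ p ∈ P, ∃ q ∈ P, p ≠ q ∧ dist p q = 1 ∧ s = s(p, q)} ≤
      (unitIncidences P).card := by
  classical
  refine le_trans ?_ (Finset.card_image_le (s := unitIncidences P) (f := fun t => s(t.1, t.2)))
  rw [← Set.ncard_coe_finset]
  refine Set.ncard_le_ncard ?_ (Finset.finite_toSet _)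
  rintro s ⟨p, hp, q, hq, hne, hd, rfl⟩
  rw [Finset.mem_coe, Finset.mem_image]
  have h : UnitAbove p q ∨ UnitAbove q p := by
    rcases lt_trichotomy (p 1) (q 1) with h1 | h1 | h1
    · exact Or.inl ⟨hd, Or.inl h1⟩
    · rcases lt_trichotomy (p 0) (q 0) with h0 | h0 | h0
      · exact Or.inl ⟨hd, Or.inr ⟨h1, h0⟩⟩
      · exact absurd (Plane.ext h0 h1) hne
      · exact Or.inr ⟨by rw [dist_comm, hd], Or.inr ⟨h1.symm, h0⟩⟩
    · exact Or.inr ⟨by rw [dist_comm, hd], Or.inl h1⟩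
  rcases h with h | h
  · exact ⟨(p, q), mem_unitIncidences.2 ⟨hp, hq, h⟩, rfl⟩
  · exact ⟨(q, p), mem_unitIncidences.2 ⟨hq, hp, h⟩, Sym2.eq_swap⟩

lemma card_unitIncidences_le_offDiag (P : Finset Plane) :
    (unitIncidences P).card ≤ P.card * P.card - P.card := by
  classical
  rw [← Finset.offDiag_card]
  refine Finset.card_le_card fun t ht => ?_
  obtain ⟨h1, h2, h3, _⟩ := mem_unitIncidences.1 ht
  refine Finset.mem_offDiag.2 ⟨h1, h2, fun h => ?_⟩
  rw [h, dist_self] at h3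
  exact zero_ne_one h3

theorem unit_distances_bound (n : ℕ) (hn : 2 ≤ n)
    (P : Finset (EuclideanSpace ℝ (Fin 2))) (hP : P.card = n) (u : ℕ)
    (hu : u = Set.ncard {s : Sym2 (EuclideanSpace ℝ (Fin 2)) |
      ∃ p ∈ P, ∃ q ∈ P, p ≠ q ∧ dist p q = 1 ∧ s = s(p, q)})
    (hbig : u > 4 * n) :
    (u : ℝ) ≤ (100 * (n : ℝ) ^ 3 * ((n : ℝ) - 1)) ^ ((1 : ℝ) / 3) := by
  have hI := ncard_unitDistancePairs_le P
  rw [← hu] at hI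
  have hI2 := card_unitIncidences_le_offDiag P
  have hI3 := card_unitIncidences_le P
  have hX := card_crossings_unitArcs_le P
  rw [hP] at hI2 hI3 hX
  have hn2 : (2 : ℝ) ≤ n := by exact_mod_cast hn
  have hu0 : (0 : ℝ) ≤ u := Nat.cast_nonneg u
  have hn6 : (6 : ℝ) ≤ n := by
    have h1 : 4 * n < n * n - n := by omega
    have h2 : 5 * n < n * n := by omega
    have h3 : 5 < n := lt_of_mul_lt_mul_right h2 (Nat.zero_le n)
    exact_mod_cast h3
  have hX' : ((crossings (unitArcs P)).card : ℝ) ≤ n * (n - 1) := by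
    have h1 : (crossings (unitArcs P)).card + n ≤ n * n := by
      have : n ≤ n * n := Nat.le_mul_self n
      omega
    have h2 : ((crossings (unitArcs P)).card : ℝ) + n ≤ n * n := by exact_mod_cast h1
    linarith
  have hE : (u : ℝ) - n ≤ (unitArcs P).card := by
    have h1 : u ≤ (unitArcs P).card + n := by omega
    have h2 : (u : ℝ) ≤ (unitArcs P).card + n := by exact_mod_cast h1
    linarith
  have hbase : (0 : ℝ) ≤ 100 * (n : ℝ) ^ 3 * ((n : ℝ) - 1) :=
    mul_nonneg (by positivity) (by linarith)
  rw [one_div, Real.le_rpow_inv_iff_of_pos hu0 hbase (by norm_num)]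
  rw [show ((3 : ℝ)) = ((3 : ℕ) : ℝ) by norm_num, Real.rpow_natCast]
  by_contra! hcon
  have h75 : 15 / 2 * (n : ℝ) ≤ u := by
    by_contra! hlt
    have h1 : (u : ℝ) ^ 3 < (15 / 2 * (n : ℝ)) ^ 3 := pow_lt_pow_left₀ hlt hu0 (by norm_num)
    have h2 : (n : ℝ) ^ 3 * 5 ≤ (n : ℝ) ^ 3 * (n - 1) :=
      mul_le_mul_of_nonneg_left (by linarith) (by positivity)
    have h3 : (0 : ℝ) < (n : ℝ) ^ 3 := by positivity
    nlinarith
  have hm : 13 / 15 * (u : ℝ) ≤ (unitArcs P).card := by linarith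
  have hlarge : 4 * P.card ≤ (unitArcs P).card := by
    have : 4 * (n : ℝ) ≤ (unitArcs P).card := by linarith
    rw [hP]
    exact_mod_cast this
  have hcr := crossing_inequality (fun e he => (mem_unitArcs.1 he).2) (by omega) hlarge
  rw [hP] at hcr
  have h1 : (13 / 15 * (u : ℝ)) ^ 3 ≤ ((unitArcs P).card : ℝ) ^ 3 :=
    pow_le_pow_left₀ (by positivity) hm 3
  have h2 : 64 * (n : ℝ) ^ 2 * (crossings (unitArcs P)).card ≤ 64 * (n : ℝ) ^ 2 * (n * (n - 1)) :=
    mul_le_mul_of_nonneg_left hX' (by positivity)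
  have h3 : 0 ≤ (n : ℝ) ^ 3 * (n - 1) := mul_nonneg (by positivity) (by linarith)
  nlinarith
end

section
/- Let P be a finite set of points and L a finite set of lines in ℝ², with every point of P on at least one line of L and every line of L containing at least one point of P. If the number of incidences I(P,L) satisfies I(P,L) − |L| > 4|P|, then I(P,L) − |L| ≤ (100·|P|²·|L|²)^{1/3}. -/
/-- A line in the plane: a one-dimensional affine subspace. -/
def IsLine (s : Set (EuclideanSpace ℝ (Fin 2))) : Prop :=
  ∃ p v : EuclideanSpace ℝ (Fin 2), v ≠ 0 ∧ s = {x | ∃ t : ℝ, x = p + t • v}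

open Finset

/-- An affine function that is positive at `s` and negative at `t` vanishes strictly between. -/
lemma exists_affine_eq_zero_between {a b s t : ℝ} (hs : 0 < a * s + b) (ht : a * t + b < 0) :
    ∃ z, a * z + b = 0 ∧ min s t < z ∧ z < max s t := by
  have ha : a ≠ 0 := by
    rintro rfl
    linarith
  refine ⟨-b / a, by field_simp; ring, ?_, ?_⟩
  · rcases lt_or_gt_of_ne ha with ha | ha
    · refine (min_le_left _ _).trans_lt ?_
      rw [lt_div_iff_of_neg ha]; linarith
    · refine (min_le_right _ _).trans_lt ?_
      rw [lt_div_iff₀ ha]; linarith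
  · rcases lt_or_gt_of_ne ha with ha | ha
    · refine lt_of_lt_of_le ?_ (le_max_right _ _)
      rw [div_lt_iff_of_neg ha]; linarith
    · refine lt_of_lt_of_le ?_ (le_max_left _ _)
      rw [div_lt_iff₀ ha]; linarith

/-- Straight-line edges `e ∈ E` with left end `l e`, right end `r e`, on the line
`y = m e * x + c e`, whose vertices have distinct abscissae and do not lie inside any edge. -/
structure IsSegmentDrawing {α ι : Type*} (P : Finset α) (E : Finset ι) (x y : α → ℝ)
    (l r : ι → α) (m c : ι → ℝ) : Prop where
  inj : Set.InjOn x P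
  left_mem : ∀ e ∈ E, l e ∈ P
  right_mem : ∀ e ∈ E, r e ∈ P
  lt : ∀ e ∈ E, x (l e) < x (r e)
  left_eq : ∀ e ∈ E, y (l e) = m e * x (l e) + c e
  right_eq : ∀ e ∈ E, y (r e) = m e * x (r e) + c e
  vertex : ∀ e ∈ E, ∀ w ∈ P, x (l e) < x w → x w < x (r e) → y w ≠ m e * x w + c e

/-- The interiors of the edges `e` and `g` meet above the abscissa `t`. -/
def CrossAt {α ι : Type*} (x : α → ℝ) (l r : ι → α) (m c : ι → ℝ) (e g : ι) (t : ℝ) : Prop :=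
  x (l e) < t ∧ x (l g) < t ∧ t < x (r e) ∧ t < x (r g) ∧ m e * t + c e = m g * t + c g

/-- The edge `e` is the first one met by the upward vertical ray from `w`. -/
def IsDirectlyAbove {α ι : Type*} (E : Finset ι) (x y : α → ℝ)
    (l r : ι → α) (m c : ι → ℝ) (w : α) (e : ι) : Prop :=
  x (l e) < x w ∧ x w < x (r e) ∧ y w < m e * x w + c e ∧
    ∀ k ∈ E, x (l k) < x w → x w < x (r k) → y w < m k * x w + c k →
      m e * x w + c e ≤ m k * x w + c k

section Planar

variable {α ι : Type*} {P : Finset α} {E : Finset ι} {x y : α → ℝ}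
  {l r : ι → α} {m c : ι → ℝ}

lemma IsSegmentDrawing.reflect (h : IsSegmentDrawing P E x y l r m c) :
    IsSegmentDrawing P E (fun a => -x a) y r l (fun e => -m e) c where
  inj := fun a ha b hb hab => h.inj ha hb (neg_injective hab)
  left_mem := h.right_mem
  right_mem := h.left_mem
  lt := fun e he => neg_lt_neg (h.lt e he)
  left_eq := fun e he => by simpa using h.right_eq e he
  right_eq := fun e he => by simpa using h.left_eq e he
  vertex := fun e he w hw h1 h2 => by
    simpa using h.vertex e he w hw (by linarith) (by linarith)

lemma CrossAt.reflect {e g : ι} {t : ℝ}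
    (h : CrossAt (fun a => -x a) r l (fun e => -m e) c e g t) : CrossAt x l r m c e g (-t) := by
  obtain ⟨h1, h2, h3, h4, h5⟩ := h
  exact ⟨by linarith, by linarith, by linarith, by linarith, by linarith⟩

lemma IsDirectlyAbove.reflect {w : α} {e : ι}
    (h : IsDirectlyAbove E (fun a => -x a) y r l (fun e => -m e) c w e) :
    IsDirectlyAbove E x y l r m c w e := by
  obtain ⟨h1, h2, h3, h4⟩ := h
  refine ⟨by linarith, by linarith, by linarith, fun k hk h5 h6 h7 => ?_⟩
  have := h4 k hk (by linarith) (by linarith) (by linarith)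
  linarith

/-- Two noncrossing edges keep their vertical order on the common part of their ranges. -/
lemma le_of_lt_of_not_crossAt {e g : ι} (hcr : ∀ t, ¬ CrossAt x l r m c e g t) {s t : ℝ}
    (hse : x (l e) ≤ s) (hsg : x (l g) ≤ s) (hse' : s ≤ x (r e)) (hsg' : s ≤ x (r g))
    (hte : x (l e) ≤ t) (htg : x (l g) ≤ t) (hte' : t ≤ x (r e)) (htg' : t ≤ x (r g))
    (hs : m e * s + c e < m g * s + c g) : m e * t + c e ≤ m g * t + c g := by
  by_contra! ht
  obtain ⟨z, hz, hz1, hz2⟩ := exists_affine_eq_zero_between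
    (a := m g - m e) (b := c g - c e) (s := s) (t := t) (by linarith) (by linarith)
  exact hcr z ⟨(le_min hse hte).trans_lt hz1, (le_min hsg htg).trans_lt hz1,
    hz2.trans_le (max_le hse' hte'), hz2.trans_le (max_le hsg' htg'), by linarith⟩

/-- If the edge `h` next below `e` at the left end of `e` is shorter than `e`, then some vertex
has `e` directly above it. -/
lemma IsSegmentDrawing.exists_isDirectlyAbove (hd : IsSegmentDrawing P E x y l r m c)
    (hcr : ∀ e ∈ E, ∀ g ∈ E, e ≠ g → ∀ t, ¬ CrossAt x l r m c e g t)
    {e h : ι} (he : e ∈ E) (hh : h ∈ E) (hl : l h = l e) (hm : m h < m e)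
    (hmax : ∀ k ∈ E, l k = l e → m k < m e → m k ≤ m h) (hr : x (r h) < x (r e)) :
    ∃ w ∈ P, IsDirectlyAbove E x y l r m c w e := by
  classical
  have hce := hd.left_eq e he
  have hch := hd.left_eq h hh
  rw [hl] at hch
  have hlh := hd.lt h hh
  rw [hl] at hlh
  let W := P.filter fun w => x (l e) < x w ∧ x w ≤ x (r h) ∧ m h * x w + c h ≤ y w ∧
    y w < m e * x w + c e
  have hW : W.Nonempty := by
    refine ⟨r h, mem_filter.2 ⟨hd.right_mem h hh, hlh, le_rfl, (hd.right_eq h hh).ge, ?_⟩⟩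
    rw [hd.right_eq h hh]
    nlinarith
  obtain ⟨w, hw, hmin⟩ := W.exists_min_image x hW
  obtain ⟨hwP, hw1, hw2, hw3, hw4⟩ := mem_filter.1 hw
  refine ⟨w, hwP, hw1, by linarith, hw4, fun k hk hk1 hk2 hk3 => ?_⟩
  by_contra! hk4
  have hke : k ≠ e := by rintro rfl; exact lt_irrefl _ hk4
  have hkh : h ≠ k := by rintro rfl; linarith
  have above : ∀ t, x (l e) ≤ t → x (l k) ≤ t → t ≤ x w → m h * t + c h ≤ m k * t + c k :=
    fun t h1 h2 h3 => le_of_lt_of_not_crossAt (s := x w) (hcr h hh k hk hkh)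
      (hl ▸ hw1.le) hk1.le hw2 hk2.le (hl ▸ h1) h2 (h3.trans hw2) (h3.trans hk2.le) (by linarith)
  have below : ∀ t, x (l e) ≤ t → x (l k) ≤ t → t ≤ x w → m k * t + c k ≤ m e * t + c e :=
    fun t h1 h2 h3 => le_of_lt_of_not_crossAt (s := x w) (hcr k hk e he hke)
      hk1.le hw1.le hk2.le (by linarith) h2 h1 (h3.trans hk2.le) (by linarith) hk4
  rcases lt_or_ge (x (l e)) (x (l k)) with hc | hc
  · have h1 := above (x (l k)) hc.le le_rfl hk1.le
    have h2 := below (x (l k)) hc.le le_rfl hk1.le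
    have hy := hd.left_eq k hk
    have h3 := hd.vertex e he (l k) (hd.left_mem k hk) hc (by linarith)
    have := hmin (l k) (mem_filter.2 ⟨hd.left_mem k hk, hc, by linarith, by linarith,
      lt_of_le_of_ne (by linarith) h3⟩)
    linarith
  · have h1 := above (x (l e)) le_rfl hc hw1.le
    have h2 := below (x (l e)) le_rfl hc hw1.le
    rcases hc.lt_or_eq with hc | hc
    · exact hd.vertex k hk (l e) (hd.left_mem e he) hc (by linarith) (by linarith)
    · have hlk : l k = l e := hd.inj (hd.left_mem k hk) (hd.left_mem e he) hc
      have hck := hd.left_eq k hk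
      rw [hlk] at hck
      have h3 : m k < m e := by nlinarith
      have h4 := hmax k hk hlk h3
      nlinarith

lemma IsSegmentDrawing.below_trichotomy (hd : IsSegmentDrawing P E x y l r m c)
    (hcr : ∀ e ∈ E, ∀ g ∈ E, e ≠ g → ∀ t, ¬ CrossAt x l r m c e g t) {e : ι} (he : e ∈ E) :
    (∃ w ∈ P, IsDirectlyAbove E x y l r m c w e) ∨
      (∀ g ∈ E, l g = l e → m e ≤ m g) ∨ (∀ g ∈ E, r g = r e → m g ≤ m e) := by
  classical
  by_contra! hcon
  obtain ⟨hno, ⟨g₁, hg₁, hg₁l, hg₁m⟩, ⟨g₂, hg₂, hg₂r, hg₂m⟩⟩ := hcon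
  obtain ⟨h, hh, hmax⟩ := (E.filter fun g => l g = l e ∧ m g < m e).exists_max_image m
    ⟨g₁, mem_filter.2 ⟨hg₁, hg₁l, hg₁m⟩⟩
  obtain ⟨k, hk, hmin⟩ := (E.filter fun g => r g = r e ∧ m e < m g).exists_min_image m
    ⟨g₂, mem_filter.2 ⟨hg₂, hg₂r, hg₂m⟩⟩
  obtain ⟨hh, hhl, hhm⟩ := mem_filter.1 hh
  obtain ⟨hk, hkr, hkm⟩ := mem_filter.1 hk
  have h1 : x (r e) ≤ x (r h) := by
    by_contra! hlt
    obtain ⟨w, hw, hw'⟩ := hd.exists_isDirectlyAbove hcr he hh hhl hhm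
      (fun k hk h1 h2 => hmax k (mem_filter.2 ⟨hk, h1, h2⟩)) hlt
    exact hno w hw hw'
  have h2 : x (l k) ≤ x (l e) := by
    by_contra! hlt
    obtain ⟨w, hw, hw'⟩ := hd.reflect.exists_isDirectlyAbove
      (fun e he g hg hne t ht => hcr e he g hg hne _ ht.reflect) he hk hkr (neg_lt_neg hkm)
      (fun k hk h1 h2 => neg_le_neg (hmin k (mem_filter.2 ⟨hk, h1, neg_lt_neg_iff.1 h2⟩)))
      (neg_lt_neg hlt)
    exact hno w hw hw'.reflect
  have hlt := hd.lt e he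
  have e1 := hd.left_eq e he
  have e2 := hd.right_eq e he
  have e3 := hd.left_eq h hh
  have e4 := hd.right_eq k hk
  rw [hhl] at e3
  rw [hkr] at e4
  have hkh : k ≠ h := by rintro rfl; linarith
  have := le_of_lt_of_not_crossAt (s := x (l e)) (t := x (r e)) (hcr k hk h hh hkh) h2
    (by rw [hhl]) (by rw [hkr]; exact hlt.le) (by linarith) (by linarith)
    (by rw [hhl]; exact hlt.le) (by rw [hkr]) h1 (by nlinarith)
  nlinarith

/-- A noncrossing straight-line drawing on `n` vertices has at most `3 n` edges. -/
lemma IsSegmentDrawing.card_le_of_noncrossing (hd : IsSegmentDrawing P E x y l r m c)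
    (hcr : ∀ e ∈ E, ∀ g ∈ E, e ≠ g → ∀ t, ¬ CrossAt x l r m c e g t) :
    E.card ≤ 3 * P.card := by
  classical
  let A := E.filter fun e => ∃ w ∈ P, IsDirectlyAbove E x y l r m c w e
  let B := E.filter fun e => ∀ g ∈ E, l g = l e → m e ≤ m g
  let C := E.filter fun e => ∀ g ∈ E, r g = r e → m g ≤ m e
  have hE : E ⊆ A ∪ (B ∪ C) := fun e he => by
    simpa only [A, B, C, mem_union, mem_filter, he, true_and] using hd.below_trichotomy hcr he
  have hA : A.card ≤ P.card := by
    refine card_le_card_of_forall_subsingleton (fun e w => IsDirectlyAbove E x y l r m c w e)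
      (fun e he => (mem_filter.1 he).2) fun w _ e he g hg => ?_
    by_contra hne
    have heE := (mem_filter.1 he.1).1
    have hgE := (mem_filter.1 hg.1).1
    obtain ⟨a1, a2, a3, a4⟩ := he.2
    obtain ⟨b1, b2, b3, b4⟩ := hg.2
    exact hcr e heE g hgE hne _ ⟨a1, b1, a2, b2, le_antisymm (a4 g hgE b1 b2 b3)
      (b4 e heE a1 a2 a3)⟩
  have hB : B.card ≤ P.card := by
    refine card_le_card_of_injOn l (fun e he => hd.left_mem e (mem_filter.1 he).1)
      fun e he g hg hfg => ?_
    by_contra hne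
    obtain ⟨heE, he'⟩ := mem_filter.1 he
    obtain ⟨hgE, hg'⟩ := mem_filter.1 hg
    have hm := le_antisymm (he' g hgE hfg.symm) (hg' e heE hfg)
    have h1 := hd.left_eq e heE
    have h2 := hd.left_eq g hgE
    rw [← hfg, ← hm] at h2
    obtain ⟨t, ht, ht'⟩ := exists_between (lt_min (hd.lt e heE) (hfg ▸ hd.lt g hgE))
    exact hcr e heE g hgE hne t ⟨ht, hfg ▸ ht, ht'.trans_le (min_le_left _ _),
      ht'.trans_le (min_le_right _ _), by rw [← hm]; linarith⟩
  have hC : C.card ≤ P.card := by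
    refine card_le_card_of_injOn r (fun e he => hd.right_mem e (mem_filter.1 he).1)
      fun e he g hg hfg => ?_
    by_contra hne
    obtain ⟨heE, he'⟩ := mem_filter.1 he
    obtain ⟨hgE, hg'⟩ := mem_filter.1 hg
    have hm := le_antisymm (hg' e heE hfg) (he' g hgE hfg.symm)
    have h1 := hd.right_eq e heE
    have h2 := hd.right_eq g hgE
    rw [← hfg, ← hm] at h2
    obtain ⟨t, ht, ht'⟩ := exists_between (max_lt (hd.lt e heE) (hfg ▸ hd.lt g hgE))
    exact hcr e heE g hgE hne t ⟨(le_max_left _ _).trans_lt ht, (le_max_right _ _).trans_lt ht,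
      ht', hfg ▸ ht', by rw [← hm]; linarith⟩
  have h1 := card_le_card hE
  have h2 := card_union_le A (B ∪ C)
  have h3 := card_union_le B C
  omega

/-- Deleting one edge from each crossing pair leaves a noncrossing drawing. -/
lemma IsSegmentDrawing.card_le_add_crossings (hd : IsSegmentDrawing P E x y l r m c)
    {X : Finset (ι × ι)}
    (hX : ∀ e ∈ E, ∀ g ∈ E, e ≠ g → ∀ t, CrossAt x l r m c e g t → (e, g) ∈ X) :
    E.card ≤ 3 * P.card + X.card := by
  classical
  have hsub : E \ X.image Prod.fst ⊆ E := sdiff_subset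
  have hd' : IsSegmentDrawing P (E \ X.image Prod.fst) x y l r m c :=
    ⟨hd.inj, fun e he => hd.left_mem e (hsub he), fun e he => hd.right_mem e (hsub he),
      fun e he => hd.lt e (hsub he), fun e he => hd.left_eq e (hsub he),
      fun e he => hd.right_eq e (hsub he), fun e he => hd.vertex e (hsub he)⟩
  have h1 := hd'.card_le_of_noncrossing fun e he g hg hne t ht =>
    (mem_sdiff.1 he).2 (mem_image_of_mem Prod.fst (hX e (hsub he) g (hsub hg) hne t ht))
  have h2 : E.card ≤ (E \ X.image Prod.fst).card + (X.image Prod.fst).card := by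
    have := le_card_sdiff (X.image Prod.fst) E
    omega
  have h3 : (X.image Prod.fst).card ≤ X.card := card_image_le
  omega

end Planar

section Sampling

variable {α κ : Type*} [DecidableEq α]

/-- A random subset of `P` containing each point independently with probability `p` contains
`T ⊆ P` with probability `p ^ #T`. -/
lemma sum_bernoulli_weight_superset {P T : Finset α} (hT : T ⊆ P) (p : ℝ) :
    ∑ S ∈ P.powerset with T ⊆ S, p ^ S.card * (1 - p) ^ (P.card - S.card) = p ^ T.card := by
  have h : ∑ S ∈ (P \ T).powerset,
      p ^ T.card * (p ^ S.card * (1 - p) ^ ((P \ T).card - S.card)) = p ^ T.card := by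
    rw [← mul_sum, Finset.sum_pow_mul_eq_add_pow]
    simp
  refine Eq.trans ?_ h
  refine sum_bij' (fun S _ => S \ T) (fun S _ => S ∪ T) ?_ ?_ ?_ ?_ ?_
  · intro S hS
    simp only [mem_filter, mem_powerset] at hS ⊢
    exact sdiff_subset_sdiff hS.1 le_rfl
  · intro S hS
    simp only [mem_filter, mem_powerset] at hS ⊢
    exact ⟨union_subset (hS.trans sdiff_subset) hT, subset_union_right⟩
  · intro S hS
    simp only [mem_filter, mem_powerset] at hS
    exact sdiff_union_of_subset hS.2
  · intro S hS
    simp only [mem_powerset] at hS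
    exact union_sdiff_cancel_right (disjoint_of_subset_left hS sdiff_disjoint)
  · intro S hS
    simp only [mem_filter, mem_powerset] at hS
    have h1 := card_sdiff_add_card_eq_card hS.2
    have h2 := card_sdiff_add_card_eq_card hT
    have h3 := card_le_card hS.1
    have h4 := card_le_card hS.2
    have h5 : (P \ T).card - (S \ T).card = P.card - S.card := by omega
    rw [← mul_assoc, ← pow_add, h5, add_comm, h1]

lemma sum_bernoulli_weight_mul_card {P : Finset α} (F : Finset κ) (T : κ → Finset α) {d : ℕ}
    (hT : ∀ k ∈ F, T k ⊆ P) (hd : ∀ k ∈ F, (T k).card = d) (p : ℝ) :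
    ∑ S ∈ P.powerset, p ^ S.card * (1 - p) ^ (P.card - S.card) *
      ((F.filter fun k => T k ⊆ S).card : ℝ) = F.card * p ^ d := by
  simp_rw [card_filter, Nat.cast_sum, mul_sum]
  rw [sum_comm, ← nsmul_eq_mul, ← sum_const]
  refine sum_congr rfl fun k hk => ?_
  rw [← hd k hk, ← sum_bernoulli_weight_superset (hT k hk) p, sum_filter]
  exact sum_congr rfl fun S _ => by split_ifs <;> simp

end Sampling

/-- The crossing inequality for straight-line drawings; `X` consists of ordered pairs. -/
lemma IsSegmentDrawing.crossing_inequality {α ι : Type*} [DecidableEq α] {P : Finset α}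
    {E : Finset ι} {x y : α → ℝ} {l r : ι → α} {m c : ι → ℝ}
    (hd : IsSegmentDrawing P E x y l r m c) {X : Finset (ι × ι)}
    (hX : ∀ e ∈ E, ∀ g ∈ E, e ≠ g → ∀ t, CrossAt x l r m c e g t → (e, g) ∈ X)
    (hXE : ∀ q ∈ X, q.1 ∈ E ∧ q.2 ∈ E)
    (hX4 : ∀ q ∈ X, ({l q.1, r q.1, l q.2, r q.2} : Finset α).card = 4)
    (hbig : 4 * P.card < E.card) :
    (E.card : ℝ) ^ 3 ≤ 64 * (P.card : ℝ) ^ 2 * X.card := by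
  have hsample : ∀ S ∈ P.powerset, ((E.filter fun e => {l e, r e} ⊆ S).card : ℝ) ≤
      3 * (P.filter fun v => {v} ⊆ S).card +
        (X.filter fun q => {l q.1, r q.1, l q.2, r q.2} ⊆ S).card := by
    intro S hS
    rw [mem_powerset] at hS
    have hSP : (P.filter fun v => {v} ⊆ S) = S := by
      ext v
      simp only [mem_filter, singleton_subset_iff, and_iff_right_iff_imp]
      exact fun h => hS h
    rw [hSP]
    have hends : ∀ e ∈ E.filter (fun e => {l e, r e} ⊆ S), e ∈ E ∧ l e ∈ S ∧ r e ∈ S :=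
      fun e he => by simpa [insert_subset_iff] using he
    have hdS : IsSegmentDrawing S (E.filter fun e => {l e, r e} ⊆ S) x y l r m c :=
      ⟨hd.inj.mono hS, fun e he => (hends e he).2.1, fun e he => (hends e he).2.2,
        fun e he => hd.lt e (hends e he).1, fun e he => hd.left_eq e (hends e he).1,
        fun e he => hd.right_eq e (hends e he).1,
        fun e he w hw => hd.vertex e (hends e he).1 w (hS hw)⟩
    have := hdS.card_le_add_crossings
      (X := X.filter fun q => {l q.1, r q.1, l q.2, r q.2} ⊆ S) fun e he g hg hne t ht => by
        obtain ⟨he, he1, he2⟩ := hends e he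
        obtain ⟨hg, hg1, hg2⟩ := hends g hg
        exact mem_filter.2 ⟨hX e he g hg hne t ht, by simp [insert_subset_iff, *]⟩
    exact_mod_cast this
  have hEpos : (0 : ℝ) < E.card := by
    have : 0 < E.card := by omega
    exact_mod_cast this
  have hPpos : (0 : ℝ) < P.card := by
    obtain ⟨e, he⟩ := card_pos.1 (show 0 < E.card by omega)
    exact_mod_cast card_pos.2 ⟨_, hd.left_mem e he⟩
  obtain ⟨p, hp⟩ : ∃ p : ℝ, p = 4 * P.card / E.card := ⟨_, rfl⟩
  have hp0 : 0 < p := by rw [hp]; positivity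
  have hp1 : p ≤ 1 := by
    rw [hp, div_le_one hEpos]
    exact_mod_cast hbig.le
  have hpE : p * E.card = 4 * P.card := by rw [hp]; field_simp
  have hsum := sum_le_sum fun S hS => mul_le_mul_of_nonneg_left (hsample S hS)
    (show 0 ≤ p ^ S.card * (1 - p) ^ (P.card - S.card) from
      mul_nonneg (pow_nonneg hp0.le _) (pow_nonneg (by linarith) _))
  simp_rw [mul_add, mul_left_comm _ (3 : ℝ)] at hsum
  rw [sum_add_distrib, ← mul_sum,
    sum_bernoulli_weight_mul_card E (fun e => {l e, r e}) (d := 2)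
      (fun e he => by simp [insert_subset_iff, hd.left_mem e he, hd.right_mem e he])
      (fun e he => card_pair fun h => (hd.lt e he).ne (congrArg x h)),
    sum_bernoulli_weight_mul_card P (fun v => {v}) (d := 1)
      (fun v hv => by simpa using hv) (fun v _ => card_singleton v),
    sum_bernoulli_weight_mul_card X (fun q => {l q.1, r q.1, l q.2, r q.2}) (d := 4)
      (fun q hq => by
        obtain ⟨h1, h2⟩ := hXE q hq
        simp [insert_subset_iff, hd.left_mem, hd.right_mem, h1, h2]) hX4] at hsum
  have hn : (P.card : ℝ) ≤ p ^ 3 * X.card := by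
    have h1 : p * P.card ≤ p * (p ^ 3 * X.card) := by
      have h2 : (E.card : ℝ) * p ^ 2 = 4 * P.card * p := by rw [← hpE]; ring
      nlinarith
    exact le_of_mul_le_mul_left h1 hp0
  have hcube : (P.card : ℝ) * E.card ^ 3 ≤ P.card * (64 * P.card ^ 2 * X.card) :=
    calc (P.card : ℝ) * E.card ^ 3 ≤ p ^ 3 * X.card * E.card ^ 3 := by gcongr
      _ = (p * E.card) ^ 3 * X.card := by ring
      _ = P.card * (64 * P.card ^ 2 * X.card) := by rw [hpE]; ring
  exact le_of_mul_le_mul_left hcube hPpos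

/-- Two affine functions agreeing at two points have the same coefficients. -/
lemma affine_coeff_eq {a b a' b' s t : ℝ} (hst : s ≠ t) (hs : a * s + b = a' * s + b')
    (ht : a * t + b = a' * t + b') : a = a' ∧ b = b' := by
  have h : (a - a') * (s - t) = 0 := by linarith
  have ha : a = a' := by
    rcases mul_eq_zero.1 h with h | h
    · linarith
    · exact absurd (by linarith) hst
  refine ⟨ha, ?_⟩
  rw [ha] at hs
  linarith

/-- The crossing inequality for the drawing whose edge `(v, ℓ)` joins the point `v` of the line
`ℓ` to the preceding point of `P` on `ℓ`: any two lines contribute at most one crossing. -/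
lemma card_consecutive_pow_three_le {α : Type*} [DecidableEq α] {P : Finset α}
    {L : Finset (Set α)} {E : Finset (α × Set α)} {x y : α → ℝ} {l : α × Set α → α}
    {m c : α × Set α → ℝ} (hinj : Set.InjOn x P)
    (hEm : ∀ e ∈ E, e.1 ∈ P ∧ e.2 ∈ L ∧ e.1 ∈ e.2)
    (hlP : ∀ e ∈ E, l e ∈ P) (hle : ∀ e ∈ E, l e ∈ e.2) (hlt : ∀ e ∈ E, x (l e) < x e.1)
    (hmax : ∀ e ∈ E, ∀ w ∈ P, w ∈ e.2 → x w < x e.1 → x w ≤ x (l e))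
    (hgraph : ∀ e ∈ E, ∀ q, q ∈ e.2 ↔ y q = m e * x q + c e)
    (hbig : 4 * P.card < E.card) :
    (E.card : ℝ) ^ 3 ≤ 64 * (P.card : ℝ) ^ 2 * (L.card : ℝ) ^ 2 := by
  classical
  have hd : IsSegmentDrawing P E x y l Prod.fst m c :=
    { inj := hinj
      left_mem := hlP
      right_mem := fun e he => (hEm e he).1
      lt := hlt
      left_eq := fun e he => (hgraph e he _).1 (hle e he)
      right_eq := fun e he => (hgraph e he _).1 (hEm e he).2.2
      vertex := fun e he w hw h1 h2 h3 =>
        h1.not_ge (hmax e he w hw ((hgraph e he w).2 h3) h2) }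
  have hsame : ∀ e ∈ E, ∀ g ∈ E, e.2 = g.2 → ∀ t, x (l e) < t → x (l g) < t → t < x e.1 →
      t < x g.1 → e = g := by
    intro e he g hg heg t h1 h2 h3 h4
    refine Prod.ext (hinj (hEm e he).1 (hEm g hg).1 (le_antisymm ?_ ?_)) heg
    · by_contra! hlt
      have := hmax e he g.1 (hEm g hg).1 (heg ▸ (hEm g hg).2.2) hlt
      linarith
    · by_contra! hlt
      have := hmax g hg e.1 (hEm e he).1 (heg ▸ (hEm e he).2.2) hlt
      linarith
  have hline : ∀ e ∈ E, ∀ g ∈ E, ∀ s t, s ≠ t → m e * s + c e = m g * s + c g →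
      m e * t + c e = m g * t + c g → e.2 = g.2 := by
    intro e he g hg s t hst hs ht
    obtain ⟨hm, hc⟩ := affine_coeff_eq hst hs ht
    ext q
    rw [hgraph e he, hgraph g hg, hm, hc]
  have hcoeff : ∀ e ∈ E, ∀ g ∈ E, e.2 = g.2 → m e = m g ∧ c e = c g := by
    intro e he g hg heg
    refine affine_coeff_eq (hlt e he).ne ?_ ?_
    · rw [← (hgraph e he _).1 (hle e he), ← (hgraph g hg _).1 (heg ▸ hle e he)]
    · rw [← (hgraph e he _).1 (hEm e he).2.2, ← (hgraph g hg _).1 (heg ▸ (hEm e he).2.2)]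
  let X := (E ×ˢ E).filter fun q => q.1 ≠ q.2 ∧ ∃ t, CrossAt x l Prod.fst m c q.1 q.2 t
  have hXcard : X.card ≤ (L ×ˢ L).card := by
    refine card_le_card_of_injOn (fun q => (q.1.2, q.2.2)) ?_ ?_
    · intro q hq
      have hq := (mem_product.1 (mem_filter.1 hq).1)
      exact mem_product.2 ⟨(hEm _ hq.1).2.1, (hEm _ hq.2).2.1⟩
    · rintro ⟨e, g⟩ hq ⟨e', g'⟩ hq' hqq
      obtain ⟨hE, hne, t, h1, h2, h3, h4, h5⟩ := mem_filter.1 hq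
      obtain ⟨hE', hne', t', h1', h2', h3', h4', h5'⟩ := mem_filter.1 hq'
      obtain ⟨he, hg⟩ := mem_product.1 hE
      obtain ⟨he', hg'⟩ := mem_product.1 hE'
      obtain ⟨hee, hgg⟩ := Prod.mk.inj hqq
      dsimp only at *
      obtain ⟨hme, hce⟩ := hcoeff e he e' he' hee
      obtain ⟨hmg, hcg⟩ := hcoeff g hg g' hg' hgg
      have htt : t = t' := by
        by_contra htt
        refine hne (hsame e he g hg (hline e he g hg t t' htt h5 ?_) t h1 h2 h3 h4)
        rw [hme, hce, hmg, hcg, h5']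
      subst htt
      rw [hsame e he e' he' hee t h1 h1' h3 h3', hsame g hg g' hg' hgg t h2 h2' h4 h4']
  have hX4 : ∀ q ∈ X, ({l q.1, q.1.1, l q.2, q.2.1} : Finset _).card = 4 := by
    rintro ⟨e, g⟩ hq
    obtain ⟨hE, hne, t, h1, h2, h3, h4, h5⟩ := mem_filter.1 hq
    obtain ⟨he, hg⟩ := mem_product.1 hE
    have hshare : ∀ z, z ∈ e.2 → z ∈ g.2 → x z ≠ t → False := fun z hz hz' hzt =>
      hne (hsame e he g hg (hline e he g hg _ _ hzt
        (((hgraph e he z).1 hz).symm.trans ((hgraph g hg z).1 hz')) h5) t h1 h2 h3 h4)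
    have hee := (hEm e he).2.2
    have hgg := (hEm g hg).2.2
    have hel := hle e he
    have hgl := hle g hg
    simp only at h1 h2 h3 h4
    have n1 : l e ≠ e.1 := fun h => (hlt e he).ne (congrArg x h)
    have n2 : l g ≠ g.1 := fun h => (hlt g hg).ne (congrArg x h)
    have n3 : l e ≠ l g := fun h => hshare (l e) hel (h ▸ hgl) h1.ne
    have n4 : l e ≠ g.1 := fun h => hshare (l e) hel (h ▸ hgg) h1.ne
    have n5 : e.1 ≠ l g := fun h => hshare e.1 hee (h ▸ hgl) h3.ne'
    have n6 : e.1 ≠ g.1 := fun h => hshare e.1 hee (h ▸ hgg) h3.ne'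
    simp [n1, n2, n3, n4, n5, n6]
  have key := hd.crossing_inequality (X := X)
    (fun e he g hg hne t ht => mem_filter.2 ⟨mem_product.2 ⟨he, hg⟩, hne, t, ht⟩)
    (fun q hq => mem_product.1 (mem_filter.1 hq).1) hX4
    hbig
  have hXL : (X.card : ℝ) ≤ (L.card : ℝ) ^ 2 := by
    rw [card_product] at hXcard
    rw [sq]
    exact_mod_cast hXcard
  exact key.trans (by gcongr)

/-- The Szemerédi–Trotter bound for points with distinct abscissae, where each line through two of
the points is the graph of an affine function. -/
lemma exists_incidences_le_add_lines {α : Type*} [DecidableEq α] {P : Finset α}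
    {L : Finset (Set α)} {x y : α → ℝ} (hinj : Set.InjOn x P)
    (hgraph : ∀ ℓ ∈ L, ∀ u v, u ∈ ℓ → v ∈ ℓ → x u < x v →
      ∃ m c : ℝ, ∀ q, q ∈ ℓ ↔ y q = m * x q + c)
    {J : Finset (α × Set α)} (hJ : ∀ q, q ∈ J ↔ q.1 ∈ P ∧ q.2 ∈ L ∧ q.1 ∈ q.2)
    (hbig : 4 * P.card + L.card < J.card) :
    ∃ N : ℕ, J.card ≤ N + L.card ∧ (N : ℝ) ^ 3 ≤ 64 * (P.card : ℝ) ^ 2 * (L.card : ℝ) ^ 2 := by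
  classical
  let E := J.filter fun q => ∃ u ∈ P, u ∈ q.2 ∧ x u < x q.1
  have hEm : ∀ e ∈ E, e.1 ∈ P ∧ e.2 ∈ L ∧ e.1 ∈ e.2 := fun e he =>
    (hJ e).1 (mem_filter.1 he).1
  have hcard : J.card ≤ E.card + L.card := by
    rw [← card_filter_add_card_filter_not (s := J) fun q => ∃ u ∈ P, u ∈ q.2 ∧ x u < x q.1]
    refine Nat.add_le_add_left (card_le_card_of_injOn Prod.snd ?_ ?_) _
    · exact fun q hq => ((hJ q).1 (mem_filter.1 hq).1).2.1
    · rintro ⟨a, ℓ⟩ ha ⟨b, ℓ'⟩ hb hab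
      obtain ⟨haJ, ha⟩ := mem_filter.1 ha
      obtain ⟨hbJ, hb⟩ := mem_filter.1 hb
      obtain ⟨haP, -, haℓ⟩ := (hJ _).1 haJ
      obtain ⟨hbP, -, hbℓ⟩ := (hJ _).1 hbJ
      dsimp only at *
      subst hab
      push Not at ha hb
      rw [hinj haP hbP (le_antisymm (ha b hbP hbℓ) (hb a haP haℓ))]
  have hdata : ∀ e ∈ E, ∃ (u : α) (m c : ℝ), u ∈ P ∧ u ∈ e.2 ∧
      x u < x e.1 ∧ (∀ w ∈ P, w ∈ e.2 → x w < x e.1 → x w ≤ x u) ∧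
      ∀ q, q ∈ e.2 ↔ y q = m * x q + c := by
    intro e he
    obtain ⟨heP, heL, hee⟩ := hEm e he
    obtain ⟨u₀, hu₀⟩ := (mem_filter.1 he).2
    obtain ⟨u, hu, hmax⟩ := (P.filter fun u => u ∈ e.2 ∧ x u < x e.1).exists_max_image x
      ⟨u₀, mem_filter.2 hu₀⟩
    obtain ⟨huP, hue, hlt⟩ := mem_filter.1 hu
    obtain ⟨m, c, h⟩ := hgraph e.2 heL u e.1 hue hee hlt
    exact ⟨u, m, c, huP, hue, hlt, fun w hw h1 h2 => hmax w (mem_filter.2 ⟨hw, h1, h2⟩), h⟩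
  obtain ⟨q₀, -⟩ := card_pos.1 (show 0 < J.card by omega)
  have : Nonempty α := ⟨q₀.1⟩
  choose! l m c hlP hle hlt hmax hgraph using hdata
  exact ⟨E.card, hcard,
    card_consecutive_pow_three_le hinj hEm hlP hle hlt hmax hgraph (by omega)⟩

/-- Finitely many points of the plane have distinct abscissae after a suitable shear. -/
lemma exists_injOn_shear (P : Finset (EuclideanSpace ℝ (Fin 2))) :
    ∃ τ : ℝ, Set.InjOn (fun q : EuclideanSpace ℝ (Fin 2) => q 0 + τ * q 1) P := by
  classical
  obtain ⟨τ, hτ⟩ := Infinite.exists_notMem_finset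
    ((P ×ˢ P).image fun q => (q.2 0 - q.1 0) / (q.1 1 - q.2 1))
  refine ⟨τ, fun p hp q hq hpq => ?_⟩
  simp only at hpq
  have h1 : p 1 = q 1 := by
    by_contra hne
    have hne' : p 1 - q 1 ≠ 0 := sub_ne_zero.2 hne
    refine hτ (mem_image.2 ⟨(p, q), mem_product.2 ⟨hp, hq⟩, ?_⟩)
    rw [div_eq_iff hne']
    linarith
  have h0 : p 0 = q 0 := by
    rw [h1] at hpq
    linarith
  ext i
  fin_cases i
  · exact h0
  · exact h1

/-- A line that is not vertical in sheared coordinates is the graph of an affine function. -/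
lemma IsLine.exists_eq_graph {ℓ : Set (EuclideanSpace ℝ (Fin 2))} (hℓ : IsLine ℓ) {τ : ℝ}
    {u v : EuclideanSpace ℝ (Fin 2)} (hu : u ∈ ℓ) (hv : v ∈ ℓ)
    (huv : u 0 + τ * u 1 < v 0 + τ * v 1) :
    ∃ m c : ℝ, ∀ q, q ∈ ℓ ↔ q 1 = m * (q 0 + τ * q 1) + c := by
  obtain ⟨p, d, -, rfl⟩ := hℓ
  have hd : d 0 + τ * d 1 ≠ 0 := by
    intro hd
    obtain ⟨s, rfl⟩ := hu
    obtain ⟨t, rfl⟩ := hv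
    simp only [PiLp.add_apply, PiLp.smul_apply, smul_eq_mul] at huv
    have h1 : s * (d 0 + τ * d 1) = 0 := by rw [hd, mul_zero]
    have h2 : t * (d 0 + τ * d 1) = 0 := by rw [hd, mul_zero]
    linarith
  refine ⟨d 1 / (d 0 + τ * d 1), p 1 - d 1 / (d 0 + τ * d 1) * (p 0 + τ * p 1), fun q => ?_⟩
  constructor
  · rintro ⟨t, rfl⟩
    simp only [PiLp.add_apply, PiLp.smul_apply, smul_eq_mul]
    linear_combination -t * div_mul_cancel₀ (d 1) hd
  · intro hq
    have h1 : q 1 = p 1 + (q 0 + τ * q 1 - (p 0 + τ * p 1)) / (d 0 + τ * d 1) * d 1 :=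
      hq.trans (by ring)
    have h0 : q 0 = p 0 + (q 0 + τ * q 1 - (p 0 + τ * p 1)) / (d 0 + τ * d 1) * d 0 := by
      have h2 : (q 0 + τ * q 1 - (p 0 + τ * p 1)) / (d 0 + τ * d 1) * (d 0 + τ * d 1) =
        q 0 + τ * q 1 - (p 0 + τ * p 1) := div_mul_cancel₀ _ hd
      linear_combination -1 * h2 - τ * h1
    refine ⟨(q 0 + τ * q 1 - (p 0 + τ * p 1)) / (d 0 + τ * d 1), ?_⟩
    ext i
    fin_cases i
    · simpa using h0
    · simpa using h1

theorem szemeredi_trotter_crossing_bound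
    (P : Finset (EuclideanSpace ℝ (Fin 2)))
    (L : Finset (Set (EuclideanSpace ℝ (Fin 2))))
    (hL : ∀ ℓ ∈ L, IsLine ℓ)
    (hPL : ∀ p ∈ P, ∃ ℓ ∈ L, p ∈ ℓ)
    (hLP : ∀ ℓ ∈ L, ∃ p ∈ P, p ∈ ℓ)
    (I : ℕ)
    (hI : I = Set.ncard {q : EuclideanSpace ℝ (Fin 2) × Set (EuclideanSpace ℝ (Fin 2)) |
      q.1 ∈ P ∧ q.2 ∈ L ∧ q.1 ∈ q.2})
    (hbig : (I : ℝ) - (L.card : ℝ) > 4 * (P.card : ℝ)) :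
    (I : ℝ) - (L.card : ℝ) ≤ (100 * (P.card : ℝ) ^ 2 * (L.card : ℝ) ^ 2) ^ ((1 : ℝ) / 3) := by
  classical
  obtain ⟨τ, hinj⟩ := exists_injOn_shear P
  obtain ⟨x, hx⟩ : ∃ x : EuclideanSpace ℝ (Fin 2) → ℝ, x = fun q => q 0 + τ * q 1 := ⟨_, rfl⟩
  rw [← hx] at hinj
  have hgraph : ∀ ℓ ∈ L, ∀ u v, u ∈ ℓ → v ∈ ℓ → x u < x v →
      ∃ m c : ℝ, ∀ q, q ∈ ℓ ↔ q 1 = m * x q + c := by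
    subst hx
    exact fun ℓ hℓ u v hu hv h => (hL ℓ hℓ).exists_eq_graph hu hv h
  let J := (P ×ˢ L).filter fun q => q.1 ∈ q.2
  have hIJ : I = J.card := by
    rw [hI, ← Set.ncard_coe_finset]
    congr 1
    ext q
    simp [J, and_assoc]
  have hbig' : 4 * P.card + L.card < J.card := by
    have : (4 * P.card + L.card : ℝ) < J.card := by
      rw [← hIJ]
      linarith
    exact_mod_cast this
  obtain ⟨N, hN, hN3⟩ := exists_incidences_le_add_lines (y := fun q => q 1) (J := J) hinj hgraph
    (fun q => by simp [J, and_assoc]) hbig'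
  have hIN : (I : ℝ) - L.card ≤ N := by
    rw [sub_le_iff_le_add, hIJ]
    exact_mod_cast hN
  refine hIN.trans ?_
  rw [one_div, Real.le_rpow_inv_iff_of_pos (by positivity) (by positivity) (by norm_num)]
  calc (N : ℝ) ^ (3 : ℝ) = (N : ℝ) ^ 3 := by rw [← Real.rpow_natCast]; norm_num
    _ ≤ 64 * (P.card : ℝ) ^ 2 * (L.card : ℝ) ^ 2 := hN3
    _ ≤ 100 * (P.card : ℝ) ^ 2 * (L.card : ℝ) ^ 2 := by gcongr; norm_num
end
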